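/- Corollary 2, robustness part. Suppose there exist real matrices P = Pᵀ > 0 and S_i = S_iᵀ > 0 (i = 1,…,r) such that Q_0^{(2)} < 0, where Q_0^{(2)} is the symmetric n(r+1)×n(r+1) block matrix with (1,1)-block A_{00}ᵀP + P A_{00} + Σ_{i=1}^r S_i, (1,i+1)-blocks P A_{0i}, (i+1,i+1)-blocks −S_i, other blocks above the diagonal zero, and blocks below the diagonal the transposes of those above. Then there exists R > 0 such that for every choice of delays h_i ≥ 0, every continuous parameter trajectory θ : [0,∞) → Θ with ‖θ(t)‖ < R for all t ≥ 0, and every solution x of the unforced delayed system, x is bounded and x(t) → 0 as t → ∞. -/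

import Mathlib

open Matrix Filter

/-- Index type for the `i`-th uncertainty channel (total size `dᵢ = ∑ₖ s_{ki}`). -/
abbrev DIdx {r m : ℕ} (s : Fin (r + 1) → Fin m → ℕ) (i : Fin (r + 1)) : Type :=
  (k : Fin m) × Fin (s i k)

/-- `Δᵢ(θ) = Diag(θ₁ I_{s₁ᵢ}, …, θ_m I_{s_mᵢ})`. -/
noncomputable def Delta {r m : ℕ} (s : Fin (r + 1) → Fin m → ℕ) (i : Fin (r + 1))
    (θ : Fin m → ℝ) : Matrix (DIdx s i) (DIdx s i) ℝ :=
  Matrix.diagonal fun p => θ p.1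

/-- `Aᵢ(θ) = A₀ᵢ + B_{qᵢ} Δᵢ(θ) (I − D_{pqᵢ} Δᵢ(θ))⁻¹ C_{pᵢ}`. -/
noncomputable def Amat {n r m : ℕ} (s : Fin (r + 1) → Fin m → ℕ)
    (A0 : Fin (r + 1) → Matrix (Fin n) (Fin n) ℝ)
    (Bq : (i : Fin (r + 1)) → Matrix (Fin n) (DIdx s i) ℝ)
    (Cp : (i : Fin (r + 1)) → Matrix (DIdx s i) (Fin n) ℝ)
    (Dpq : (i : Fin (r + 1)) → Matrix (DIdx s i) (DIdx s i) ℝ)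
    (i : Fin (r + 1)) (θ : Fin m → ℝ) : Matrix (Fin n) (Fin n) ℝ :=
  A0 i + Bq i * Delta s i θ * (1 - Dpq i * Delta s i θ)⁻¹ * Cp i

/-- The real symmetric `n(r+1) × n(r+1)` block matrix `Q₀⁽²⁾` of Corollary 2. -/
noncomputable def Q02 {n r : ℕ} (A0 : Fin (r + 1) → Matrix (Fin n) (Fin n) ℝ)
    (P : Matrix (Fin n) (Fin n) ℝ) (S : Fin r → Matrix (Fin n) (Fin n) ℝ) :
    Matrix (Fin (r + 1) × Fin n) (Fin (r + 1) × Fin n) ℝ :=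
  Matrix.of fun p q =>
    if hp : p.1 = 0 then
      if q.1 = 0 then ((A0 0)ᵀ * P + P * A0 0 + ∑ i : Fin r, S i) p.2 q.2
      else (P * A0 q.1) p.2 q.2
    else
      if q.1 = 0 then (P * A0 p.1)ᵀ p.2 q.2
      else if p.1 = q.1 then (-(S (p.1.pred hp))) p.2 q.2
      else 0

open scoped Topology

theorem abs_dotProduct_le_card_mul_norm {ι : Type*} [Fintype ι] (z w : ι → ℝ) :
    |z ⬝ᵥ w| ≤ Fintype.card ι * (‖z‖ * ‖w‖) := by
  calc |z ⬝ᵥ w| ≤ ∑ i, |z i * w i| := Finset.abs_sum_le_sum_abs _ _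
    _ ≤ ∑ _i : ι, ‖z‖ * ‖w‖ := by
        refine Finset.sum_le_sum fun i _ => ?_
        rw [abs_mul]
        exact mul_le_mul (norm_le_pi_norm z i) (norm_le_pi_norm w i) (abs_nonneg _) (norm_nonneg _)
    _ = Fintype.card ι * (‖z‖ * ‖w‖) := by simp

theorem Matrix.PosDef.exists_mul_norm_sq_le {ι : Type*} [Fintype ι] {M : Matrix ι ι ℝ}
    (hM : M.PosDef) : ∃ c > 0, ∀ z : ι → ℝ, c * ‖z‖ ^ 2 ≤ z ⬝ᵥ M *ᵥ z := by
  have hcont : Continuous fun z : ι → ℝ => z ⬝ᵥ M *ᵥ z := by fun_prop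
  rcases (Metric.sphere (0 : ι → ℝ) 1).eq_empty_or_nonempty with he | hne
  · refine ⟨1, one_pos, fun z => ?_⟩
    by_cases hz : z = 0
    · simp [hz]
    · have : ‖z‖⁻¹ • z ∈ Metric.sphere (0 : ι → ℝ) 1 := by
        simp [norm_smul, hz]
      simp [he] at this
  · obtain ⟨y, hy, hmin⟩ := (isCompact_sphere (0 : ι → ℝ) 1).exists_isMinOn hne hcont.continuousOn
    have hy0 : y ≠ 0 := by
      rintro rfl
      simp at hy
    refine ⟨y ⬝ᵥ M *ᵥ y, by simpa using hM.dotProduct_mulVec_pos hy0, fun z => ?_⟩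
    by_cases hz : z = 0
    · simp [hz]
    · have hmem : ‖z‖⁻¹ • z ∈ Metric.sphere (0 : ι → ℝ) 1 := by
        simp [norm_smul, hz]
      have h := isMinOn_iff.1 hmin _ hmem
      have hz' : 0 < ‖z‖ := norm_pos_iff.2 hz
      simp only [mulVec_smul, dotProduct_smul, smul_dotProduct, smul_eq_mul] at h
      calc y ⬝ᵥ M *ᵥ y * ‖z‖ ^ 2 ≤ (‖z‖⁻¹ * (‖z‖⁻¹ * z ⬝ᵥ M *ᵥ z)) * ‖z‖ ^ 2 := by gcongr
        _ = z ⬝ᵥ M *ᵥ z := by field_simp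

section OperatorNorm

open scoped Matrix.Norms.Operator

theorem ContinuousAt.exists_eventually_norm_mulVec_le {X ι κ : Type*} [TopologicalSpace X]
    [Fintype ι] [Fintype κ] {M : X → Matrix ι κ ℝ} {a : X} (hM : ContinuousAt M a) :
    ∃ K, 0 ≤ K ∧ ∀ᶠ y in 𝓝 a, ∀ z, ‖M y *ᵥ z‖ ≤ K * ‖z‖ := by
  refine ⟨‖M a‖ + 1, by positivity, ?_⟩
  filter_upwards [hM.norm.eventually (gt_mem_nhds (lt_add_one ‖M a‖))] with y hy z
  exact (linfty_opNorm_mulVec _ _).trans (by gcongr)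

theorem ContinuousAt.eventually_norm_sub_mulVec_le {X ι κ : Type*} [TopologicalSpace X]
    [Fintype ι] [Fintype κ] {M : X → Matrix ι κ ℝ} {a : X} (hM : ContinuousAt M a) {K : ℝ}
    (hK : 0 < K) : ∀ᶠ y in 𝓝 a, ∀ z, ‖(M y - M a) *ᵥ z‖ ≤ K * ‖z‖ := by
  have hE : ContinuousAt (fun y => M y - M a) a := hM.sub continuousAt_const
  filter_upwards [hE.norm.eventually (gt_mem_nhds (by simpa using hK))] with y hy z
  exact (linfty_opNorm_mulVec _ _).trans (by gcongr)

end OperatorNorm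

theorem ContinuousAt.eventually_mul_norm_sq_le {X ι : Type*} [TopologicalSpace X] [Fintype ι]
    {M : X → Matrix ι ι ℝ} {a : X} (hM : ContinuousAt M a) (hpos : (M a).PosDef) :
    ∃ c > 0, ∀ᶠ y in 𝓝 a, ∀ z : ι → ℝ, c * ‖z‖ ^ 2 ≤ z ⬝ᵥ M y *ᵥ z := by
  obtain ⟨c, hc, hle⟩ := hpos.exists_mul_norm_sq_le
  refine ⟨c / 2, half_pos hc, ?_⟩
  have hK : 0 < c / 2 / (Fintype.card ι + 1) := by positivity
  filter_upwards [hM.eventually_norm_sub_mulVec_le hK] with y hy z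
  have h1 := neg_le_of_abs_le (abs_dotProduct_le_card_mul_norm z ((M y - M a) *ᵥ z))
  have h2 : Fintype.card ι * (‖z‖ * ‖(M y - M a) *ᵥ z‖) ≤ c / 2 * ‖z‖ ^ 2 := by
    calc (Fintype.card ι : ℝ) * (‖z‖ * ‖(M y - M a) *ᵥ z‖)
        ≤ (Fintype.card ι + 1) * (‖z‖ * (c / 2 / (Fintype.card ι + 1) * ‖z‖)) := by
          gcongr
          · linarith
          · exact hy z
      _ = c / 2 * ‖z‖ ^ 2 := by field_simp
  have h3 := hle z
  rw [sub_mulVec, dotProduct_sub] at h1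
  rw [sub_mulVec] at h2
  linarith

/-- A trajectory with bounded velocity along which a nonnegative function decreases at least at
rate `ε ‖x‖²` tends to zero. -/
theorem tendsto_zero_of_lyapunov {E : Type*} [NormedAddCommGroup E] [NormedSpace ℝ E]
    {x x' : ℝ → E} {V V' : ℝ → ℝ} {L ε : ℝ} (hL : 0 < L) (hε : 0 < ε)
    (hV : ∀ t ≥ 0, 0 ≤ V t) (hVanti : AntitoneOn V (Set.Ici 0))
    (hVd : ∀ t > 0, HasDerivAt V (V' t) t) (hV' : ∀ t > 0, V' t ≤ -(ε * ‖x t‖ ^ 2))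
    (hxd : ∀ t > 0, HasDerivAt x (x' t) t) (hx' : ∀ t > 0, ‖x' t‖ ≤ L) :
    Tendsto x atTop (𝓝 0) := by
  have hW : Antitone fun t => V (max t 0) := fun a b hab =>
    hVanti (Set.mem_Ici.2 (le_max_right _ _)) (Set.mem_Ici.2 (le_max_right _ _))
      (max_le_max_right 0 hab)
  have hWlim := tendsto_atTop_ciInf hW ⟨0, by rintro _ ⟨t, rfl⟩; exact hV _ (le_max_right _ _)⟩
  rw [Metric.tendsto_atTop']
  intro δ hδ
  have hτ : 0 < δ / (2 * L) := by positivity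
  have hdiff := hWlim.sub (hWlim.comp (tendsto_atTop_add_const_right _ (δ / (2 * L)) tendsto_id))
  rw [sub_self] at hdiff
  have hd : 0 < ε * (δ / 2) ^ 2 * (δ / (2 * L)) := by positivity
  obtain ⟨T, hT⟩ := eventually_atTop.1 (hdiff.eventually (gt_mem_nhds hd))
  refine ⟨max T 0, fun t ht => ?_⟩
  have ht0 : 0 < t := (le_max_right _ _).trans_lt ht
  have hdrop := hT t ((le_max_left _ _).trans ht.le)
  have ht1 : 0 ≤ t + δ / (2 * L) := by positivity
  simp only [Function.comp, id, max_eq_left ht0.le, max_eq_left ht1] at hdrop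
  rw [dist_zero_right]
  by_contra! hge
  have hpos : ∀ s ∈ Set.Icc t (t + δ / (2 * L)), 0 < s := fun s hs => ht0.trans_le hs.1
  obtain ⟨c, hc, hslope⟩ := exists_hasDerivAt_eq_slope V V' (lt_add_of_pos_right t hτ)
    (fun s hs => (hVd s (hpos s hs)).continuousAt.continuousWithinAt)
    (fun s hs => hVd s (hpos s (Set.Ioo_subset_Icc_self hs)))
  have hlip : ‖x c - x t‖ ≤ L * ‖c - t‖ :=
    (convex_Icc t (t + δ / (2 * L))).norm_image_sub_le_of_norm_hasDerivWithin_le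
      (fun s hs => (hxd s (hpos s hs)).hasDerivWithinAt) (fun s hs => hx' s (hpos s hs))
      (Set.left_mem_Icc.2 (lt_add_of_pos_right t hτ).le) (Set.Ioo_subset_Icc_self hc)
  have hhalf : δ / 2 ≤ ‖x c‖ := by
    have h1 : ‖c - t‖ ≤ δ / (2 * L) := by
      rw [Real.norm_of_nonneg (by linarith [hc.1])]
      linarith [hc.2]
    have h2 : L * ‖c - t‖ ≤ δ / 2 :=
      calc L * ‖c - t‖ ≤ L * (δ / (2 * L)) := by gcongr
        _ = δ / 2 := by field_simp
    have h3 := norm_sub_norm_le (x t) (x c)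
    rw [norm_sub_rev] at h3
    linarith
  have hVc := hV' c (hpos c (Set.Ioo_subset_Icc_self hc))
  rw [hslope, add_sub_cancel_left, div_le_iff₀ hτ] at hVc
  have hsq : ε * (δ / 2) ^ 2 * (δ / (2 * L)) ≤ ε * ‖x c‖ ^ 2 * (δ / (2 * L)) := by gcongr
  linarith

theorem dotProduct_Q02_mulVec {n r : ℕ} (A : Fin (r + 1) → Matrix (Fin n) (Fin n) ℝ)
    {P : Matrix (Fin n) (Fin n) ℝ} (hP : Pᵀ = P) (S : Fin r → Matrix (Fin n) (Fin n) ℝ)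
    (z : Fin (r + 1) → Fin n → ℝ) :
    (fun p : Fin (r + 1) × Fin n => z p.1 p.2) ⬝ᵥ Q02 A P S *ᵥ (fun p => z p.1 p.2) =
      (∑ i, A i *ᵥ z i) ⬝ᵥ P *ᵥ z 0 + z 0 ⬝ᵥ P *ᵥ (∑ i, A i *ᵥ z i) +
        ∑ i : Fin r, (z 0 ⬝ᵥ S i *ᵥ z 0 - z i.succ ⬝ᵥ S i *ᵥ z i.succ) := by
  have hblock : (fun p : Fin (r + 1) × Fin n => z p.1 p.2) ⬝ᵥ Q02 A P S *ᵥ (fun p => z p.1 p.2) =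
      ∑ i, ∑ j, z i ⬝ᵥ (Matrix.of fun k l => Q02 A P S (i, k) (j, l)) *ᵥ z j := by
    simp only [dotProduct, mulVec, Fintype.sum_prod_type, Finset.mul_sum, of_apply]
    exact Finset.sum_congr rfl fun i _ => Finset.sum_comm
  have h00 : (Matrix.of fun k l => Q02 A P S (0, k) (0, l)) =
      (A 0)ᵀ * P + P * A 0 + ∑ i, S i := by
    ext; simp [Q02]
  have h0s (j : Fin r) : (Matrix.of fun k l => Q02 A P S (0, k) (j.succ, l)) = P * A j.succ := by
    ext; simp [Q02]
  have hs0 (i : Fin r) : (Matrix.of fun k l => Q02 A P S (i.succ, k) (0, l)) =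
      (A i.succ)ᵀ * P := by
    rw [← hP, ← transpose_mul, hP]
    ext; simp [Q02]
  have hss (i j : Fin r) : (Matrix.of fun k l => Q02 A P S (i.succ, k) (j.succ, l)) =
      if i = j then -S i else 0 := by
    ext
    by_cases h : i = j <;> simp [Q02, h]
  have hdiag (i : Fin r) : ∑ j : Fin r, z i.succ ⬝ᵥ (if i = j then -S i else 0) *ᵥ z j.succ =
      -(z i.succ ⬝ᵥ S i *ᵥ z i.succ) := by
    rw [Finset.sum_eq_single i]
    · simp [neg_mulVec]
    · intro j _ hj
      simp [hj.symm]
    · simp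
  have htr (B : Matrix (Fin n) (Fin n) ℝ) (u w : Fin n → ℝ) :
      u ⬝ᵥ Bᵀ *ᵥ w = (B *ᵥ u) ⬝ᵥ w := by
    rw [dotProduct_mulVec, vecMul_transpose]
  rw [hblock]
  simp only [Fin.sum_univ_succ, h00, h0s, hs0, hss, hdiag, add_mulVec, dotProduct_add, htr,
    sum_mulVec, mulVec_add, mulVec_sum, dotProduct_sum, sum_dotProduct, add_dotProduct,
    Finset.sum_add_distrib, Finset.sum_sub_distrib, Finset.sum_neg_distrib, ← mulVec_mulVec]
  ring

theorem continuousAt_linearFractional_zero {ι κ : Type*} [Fintype ι] [DecidableEq ι]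
    (A : Matrix κ κ ℝ) (B : Matrix κ ι ℝ) (C : Matrix ι κ ℝ) (D : Matrix ι ι ℝ) :
    ContinuousAt (fun Δ : Matrix ι ι ℝ => A + B * Δ * (1 - D * Δ)⁻¹ * C) 0 := by
  have hM : Continuous fun Δ : Matrix ι ι ℝ => 1 - D * Δ :=
    continuous_const.sub (continuous_const.matrix_mul continuous_id)
  have hinv : ContinuousAt (fun Δ : Matrix ι ι ℝ => (1 - D * Δ)⁻¹) 0 := by
    simp only [Matrix.inv_def, Ring.inverse_eq_inv']
    refine ContinuousAt.smul (hM.matrix_det.continuousAt.inv₀ ?_) hM.matrix_adjugate.continuousAt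
    simp
  have hmul : Continuous fun p : Matrix ι ι ℝ × Matrix ι ι ℝ => A + B * p.1 * p.2 * C := by
    fun_prop
  exact ContinuousAt.comp (f := fun Δ : Matrix ι ι ℝ => (Δ, (1 - D * Δ)⁻¹))
    hmul.continuousAt (continuousAt_id.prodMk hinv)

theorem continuousAt_Amat_zero {n r m : ℕ} (s : Fin (r + 1) → Fin m → ℕ)
    (A0 : Fin (r + 1) → Matrix (Fin n) (Fin n) ℝ)
    (Bq : (i : Fin (r + 1)) → Matrix (Fin n) (DIdx s i) ℝ)
    (Cp : (i : Fin (r + 1)) → Matrix (DIdx s i) (Fin n) ℝ)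
    (Dpq : (i : Fin (r + 1)) → Matrix (DIdx s i) (DIdx s i) ℝ) (i : Fin (r + 1)) :
    ContinuousAt (Amat s A0 Bq Cp Dpq i) 0 := by
  have hΔ : Continuous (Delta s i) := Continuous.matrix_diagonal (by fun_prop)
  refine ContinuousAt.comp (g := fun Δ => A0 i + Bq i * Δ * (1 - Dpq i * Δ)⁻¹ * Cp i) ?_
    hΔ.continuousAt
  have h0 : Delta s i 0 = 0 := by simp [Delta]
  rw [h0]
  exact continuousAt_linearFractional_zero _ _ _ _

theorem Amat_zero {n r m : ℕ} (s : Fin (r + 1) → Fin m → ℕ)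
    (A0 : Fin (r + 1) → Matrix (Fin n) (Fin n) ℝ)
    (Bq : (i : Fin (r + 1)) → Matrix (Fin n) (DIdx s i) ℝ)
    (Cp : (i : Fin (r + 1)) → Matrix (DIdx s i) (Fin n) ℝ)
    (Dpq : (i : Fin (r + 1)) → Matrix (DIdx s i) (DIdx s i) ℝ) :
    (fun i => Amat s A0 Bq Cp Dpq i 0) = A0 := by
  funext i
  simp [Amat, Delta]

theorem continuous_Q02 {n r : ℕ} (P : Matrix (Fin n) (Fin n) ℝ)
    (S : Fin r → Matrix (Fin n) (Fin n) ℝ) : Continuous fun A => Q02 A P S := by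
  refine continuous_matrix fun p q => ?_
  unfold Q02
  simp only [of_apply]
  split_ifs <;> fun_prop

/-- Stability of a delayed linear time-varying system with a globally continuous trajectory, under a
uniform Lyapunov–Krasovskii inequality. -/
theorem delayed_system_stable {n r : ℕ} {P : Matrix (Fin n) (Fin n) ℝ} (hPsym : Pᵀ = P)
    (hP : P.PosDef) {S : Fin r → Matrix (Fin n) (Fin n) ℝ} (hS : ∀ i, (S i).PosDef)
    {A : ℝ → Fin (r + 1) → Matrix (Fin n) (Fin n) ℝ} {ε K h : ℝ} (hε : 0 < ε) (hK : 0 ≤ K)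
    (hQ : ∀ t ≥ 0, ∀ z : Fin (r + 1) × Fin n → ℝ,
      ε * ‖z‖ ^ 2 ≤ z ⬝ᵥ (-Q02 (A t) P S) *ᵥ z)
    (hA : ∀ t ≥ 0, ∀ i z, ‖A t i *ᵥ z‖ ≤ K * ‖z‖)
    {d : Fin (r + 1) → ℝ} (hd0 : d 0 = 0) (hd : ∀ i, 0 ≤ d i) (hdh : ∀ i, d i ≤ h)
    {x : ℝ → Fin n → ℝ} (hx : Continuous x)
    (hxd : ∀ t > 0, HasDerivAt x (∑ i, A t i *ᵥ x (t - d i)) t) :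
    (∃ C, ∀ t ≥ -h, ‖x t‖ ≤ C) ∧ Tendsto x atTop (𝓝 0) := by
  have hg (i : Fin r) : Continuous fun t => x t ⬝ᵥ S i *ᵥ x t := by fun_prop
  have hg0 (i : Fin r) (t : ℝ) : 0 ≤ x t ⬝ᵥ S i *ᵥ x t := by
    simpa using (hS i).posSemidef.dotProduct_mulVec_nonneg (x t)
  set G : Fin r → ℝ → ℝ := fun i t => ∫ s in (0 : ℝ)..t, x s ⬝ᵥ S i *ᵥ x s with hG
  have hGd (i : Fin r) (t : ℝ) : HasDerivAt (G i) (x t ⬝ᵥ S i *ᵥ x t) t :=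
    (hg i).integral_hasStrictDerivAt 0 t |>.hasDerivAt
  have hGmono (i : Fin r) : Monotone (G i) :=
    monotone_of_hasDerivAt_nonneg (hGd i) (hg0 i)
  set V : ℝ → ℝ := fun t => x t ⬝ᵥ P *ᵥ x t + ∑ i : Fin r, (G i t - G i (t - d i.succ)) with hV
  set x' : ℝ → Fin n → ℝ := fun t => ∑ i, A t i *ᵥ x (t - d i) with hx'
  set V' : ℝ → ℝ := fun t => x' t ⬝ᵥ P *ᵥ x t + x t ⬝ᵥ P *ᵥ x' t +
    ∑ i : Fin r, (x t ⬝ᵥ S i *ᵥ x t - x (t - d i.succ) ⬝ᵥ S i *ᵥ x (t - d i.succ)) with hV'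
  have hVd : ∀ t > 0, HasDerivAt V (V' t) t := by
    intro t ht
    have hcoord : ∀ k, HasDerivAt (fun t => x t k) (x' t k) t := hasDerivAt_pi.1 (hxd t ht)
    have hPx : ∀ k, HasDerivAt (fun t => (P *ᵥ x t) k) ((P *ᵥ x' t) k) t := fun k =>
      HasDerivAt.fun_sum (u := Finset.univ) fun j _ => (hcoord j).const_mul (P k j)
    have hquad : HasDerivAt (fun t => x t ⬝ᵥ P *ᵥ x t)
        (x' t ⬝ᵥ P *ᵥ x t + x t ⬝ᵥ P *ᵥ x' t) t := by
      have := HasDerivAt.fun_sum (u := Finset.univ) fun k _ => (hcoord k).mul (hPx k)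
      rwa [Finset.sum_add_distrib] at this
    refine hquad.add (HasDerivAt.fun_sum fun i _ => (hGd i t).sub ?_)
    exact (hGd i (t - d i.succ)).comp_sub_const t (d i.succ)
  have hV'le : ∀ t > 0, V' t ≤ -(ε * ‖x t‖ ^ 2) := by
    intro t ht
    have h1 := hQ t ht.le fun p => x (t - d p.1) p.2
    rw [neg_mulVec, dotProduct_neg,
      dotProduct_Q02_mulVec (A t) hPsym S fun i => x (t - d i)] at h1
    simp only [hd0, sub_zero] at h1
    have h2 : ‖x t‖ ≤ ‖fun p : Fin (r + 1) × Fin n => x (t - d p.1) p.2‖ := by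
      refine (pi_norm_le_iff_of_nonneg (norm_nonneg _)).2 fun k => ?_
      simpa [hd0] using
        norm_le_pi_norm (fun p : Fin (r + 1) × Fin n => x (t - d p.1) p.2) (0, k)
    have h3 : ε * ‖x t‖ ^ 2 ≤ ε * ‖fun p : Fin (r + 1) × Fin n => x (t - d p.1) p.2‖ ^ 2 := by
      gcongr
    simp only [hV', hx']
    linarith
  have hGc (i : Fin r) : Continuous (G i) :=
    continuous_iff_continuousAt.2 fun t => (hGd i t).continuousAt
  have hVc : Continuous V := by fun_prop
  have hVanti : AntitoneOn V (Set.Ici 0) := by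
    refine antitoneOn_of_hasDerivWithinAt_nonpos (f' := V') (convex_Ici 0) hVc.continuousOn ?_ ?_
    · intro t ht
      rw [interior_Ici] at ht
      exact (hVd t ht).hasDerivWithinAt
    · intro t ht
      rw [interior_Ici] at ht
      exact (hV'le t ht).trans (neg_nonpos.2 (by positivity))
  obtain ⟨c, hc, hcP⟩ := hP.exists_mul_norm_sq_le
  have hVlow (t : ℝ) : c * ‖x t‖ ^ 2 ≤ V t := by
    have : 0 ≤ ∑ i : Fin r, (G i t - G i (t - d i.succ)) :=
      Finset.sum_nonneg fun i _ => sub_nonneg.2 (hGmono i (sub_le_self t (hd _)))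
    have := hcP (x t)
    simp only [hV]
    linarith
  have hVnn (t : ℝ) : 0 ≤ V t := le_trans (by positivity) (hVlow t)
  obtain ⟨C₀, hC₀⟩ := (isCompact_Icc (a := -h) (b := 0)).exists_bound_of_continuousOn
    hx.continuousOn
  have hbound : ∀ t ≥ -h, ‖x t‖ ≤ max C₀ √(V 0 / c) := by
    intro t ht
    rcases le_total t 0 with h0 | h0
    · exact (hC₀ t ⟨ht, h0⟩).trans (le_max_left _ _)
    · refine (Real.le_sqrt_of_sq_le ?_).trans (le_max_right _ _)
      rw [le_div_iff₀ hc, mul_comm]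
      exact (hVlow t).trans (hVanti Set.self_mem_Ici h0 h0)
  set C := max C₀ √(V 0 / c) with hC
  have hC0 : 0 ≤ C := (Real.sqrt_nonneg _).trans (le_max_right _ _)
  refine ⟨⟨C, hbound⟩, ?_⟩
  refine tendsto_zero_of_lyapunov (L := (r + 1) * (K * C) + 1) (by positivity) hε
    (fun t _ => hVnn t) hVanti hVd hV'le hxd fun t ht => ?_
  calc ‖x' t‖ ≤ ∑ _i : Fin (r + 1), K * C := by
        refine norm_sum_le_of_le _ fun i _ => (hA t ht.le i _).trans ?_
        exact mul_le_mul_of_nonneg_left (hbound _ (by linarith [hdh i])) hK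
    _ ≤ (r + 1) * (K * C) + 1 := by simp

/-- **Corollary 2, robustness part.** If `Q₀⁽²⁾ < 0` for some `P = Pᵀ > 0`, `Sᵢ = Sᵢᵀ > 0`,
then there is `R > 0` such that for every choice of delays, every continuous parameter
trajectory staying in `Θ` with `‖θ(t)‖ < R`, and every solution of the unforced delayed
system, the solution is bounded and tends to zero. -/
theorem corollary2_robustness (n r m : ℕ) (hn : 1 ≤ n) (hr : 1 ≤ r) (hm : 1 ≤ m)
    (v : ℕ) (hv : 1 ≤ v) (θvert : Fin v → Fin m → ℝ)
    (Θ : Set (Fin m → ℝ)) (hΘ : Θ = convexHull ℝ (Set.range θvert))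
    (hΘ0 : (0 : Fin m → ℝ) ∈ Θ)
    (s : Fin (r + 1) → Fin m → ℕ)
    (A0 : Fin (r + 1) → Matrix (Fin n) (Fin n) ℝ)
    (Bq : (i : Fin (r + 1)) → Matrix (Fin n) (DIdx s i) ℝ)
    (Cp : (i : Fin (r + 1)) → Matrix (DIdx s i) (Fin n) ℝ)
    (Dpq : (i : Fin (r + 1)) → Matrix (DIdx s i) (DIdx s i) ℝ)
    (hwell : ∀ θ ∈ Θ, ∀ i, (1 - Dpq i * Delta s i θ).det ≠ 0)
    (P : Matrix (Fin n) (Fin n) ℝ) (hPsym : Pᵀ = P) (hP : P.PosDef)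
    (S : Fin r → Matrix (Fin n) (Fin n) ℝ)
    (hSsym : ∀ i, (S i)ᵀ = S i) (hS : ∀ i, (S i).PosDef)
    (hQ : (-(Q02 A0 P S)).PosDef) :
    ∃ R > (0 : ℝ),
      ∀ hdel : Fin (r + 1) → ℝ, hdel 0 = 0 → (∀ i, 0 ≤ hdel i) →
        ∀ θ : ℝ → Fin m → ℝ, Continuous θ →
          (∀ t ≥ (0 : ℝ), θ t ∈ Θ) → (∀ t ≥ (0 : ℝ), ‖θ t‖ < R) →
          ∀ x : ℝ → Fin n → ℝ,
            ContinuousOn x (Set.Ici (-(⨆ i, hdel i))) →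
            (∀ t > (0 : ℝ), HasDerivAt x
              (∑ i, (Amat s A0 Bq Cp Dpq i (θ t)).mulVec (x (t - hdel i))) t) →
            (∃ C : ℝ, ∀ t ≥ -(⨆ i, hdel i), ‖x t‖ ≤ C) ∧
              Tendsto x atTop (nhds 0) := by
  have hA (i : Fin (r + 1)) := continuousAt_Amat_zero s A0 Bq Cp Dpq i
  have hQc : ContinuousAt (fun θ => -Q02 (fun i => Amat s A0 Bq Cp Dpq i θ) P S) 0 :=
    ((continuous_Q02 P S).continuousAt.comp (continuousAt_pi.2 hA)).neg
  obtain ⟨ε, hε, hQev⟩ := hQc.eventually_mul_norm_sq_le (by rwa [Amat_zero])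
  obtain ⟨K, hK, hAev⟩ : ∃ K, 0 ≤ K ∧ ∀ᶠ θ in 𝓝 0, ∀ i z,
      ‖Amat s A0 Bq Cp Dpq i θ *ᵥ z‖ ≤ K * ‖z‖ := by
    choose k hk using fun i => (hA i).exists_eventually_norm_mulVec_le
    refine ⟨∑ i, k i, Finset.sum_nonneg fun i _ => (hk i).1, ?_⟩
    filter_upwards [eventually_all.2 fun i => (hk i).2] with θ hθ i z
    refine (hθ i z).trans (mul_le_mul_of_nonneg_right ?_ (norm_nonneg z))
    exact Finset.single_le_sum (fun j _ => (hk j).1) (Finset.mem_univ i)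
  obtain ⟨R, hR, hball⟩ := Metric.eventually_nhds_iff.1 (hQev.and hAev)
  refine ⟨R, hR, fun hdel hd0 hd θ _ _ hθR x hx hxd => ?_⟩
  have hdh (i : Fin (r + 1)) : hdel i ≤ ⨆ i, hdel i := le_ciSup (Set.finite_range hdel).bddAbove i
  set h := ⨆ i, hdel i
  have hθ (t : ℝ) (ht : t ≥ 0) := hball (y := θ t) (by simpa using hθR t ht)
  have heq : ∀ t ≥ -h, x (max (-h) t) = x t := fun t ht => by rw [max_eq_right ht]
  have hxcont : Continuous fun t => x (max (-h) t) :=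
    hx.comp_continuous (by fun_prop) fun t => Set.mem_Ici.2 (le_max_left _ _)
  have hh : 0 ≤ h := (hd 0).trans (hdh 0)
  obtain ⟨⟨C, hC⟩, hlim⟩ := delayed_system_stable hPsym hP hS hε hK
    (A := fun t i => Amat s A0 Bq Cp Dpq i (θ t)) (fun t ht => (hθ t ht).1)
    (fun t ht => (hθ t ht).2) hd0 hd hdh hxcont (by
      intro t ht
      have hev : (fun t => x (max (-h) t)) =ᶠ[𝓝 t] x := by
        filter_upwards [lt_mem_nhds ht] with u hu
        exact heq u (by linarith)
      refine HasDerivAt.congr_of_eventuallyEq ?_ hev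
      have hdelay (i : Fin (r + 1)) : x (max (-h) (t - hdel i)) = x (t - hdel i) :=
        heq _ (by linarith [hdh i])
      simpa only [hdelay] using hxd t ht)
  refine ⟨⟨C, fun t ht => heq t ht ▸ hC t ht⟩, hlim.congr' ?_⟩
  filter_upwards [eventually_ge_atTop (-h)] with t ht using heq t ht
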